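/- arXiv:2503.00769 — 2 statements merged into one kernel-verified Lean document; each statement's English description precedes it below -/
import Mathlib

section
/- Let $n \geq 1$, $t_0 \in \mathbb{R}$, $\tilde{b} > 0$, $0 < \sigma < 1$, and $m \geq 0$, and set $\tilde{\sigma} = 1 - \sigma$. Let $\mu : [t_0, \infty) \to (0, \infty)$ be differentiable, strictly increasing, with $\dot{\mu}(t) \leq \tilde{b}\,\mu(t)^2$ for all $t \geq t_0$. Let $\alpha : (0,\infty) \to (0,\infty)$ be differentiable, strictly increasing, with $\frac{\mathrm{d}\alpha}{\mathrm{d}s}(s) \leq \frac{1}{2}s^{-2}\tilde{b}^{-1}\sigma\,\alpha(s)^2$ for all $s > 0$. Let $x, w : [t_0, \infty) \to \mathbb{R}^n$ with $x$ differentiable, $\|w(t)\| \leq m$, and $\dot{x}(t) = -\alpha(\mu(t))\,x(t) - w(t)$ for all $t \geq t_0$. Then for all $t \geq t_0$: $\|x(t)\| \leq \big(\alpha(\mu(t))\big)^{-1}\Big(\alpha(\mu(t_0))\,\|x(t_0)\| + \tilde{\sigma}^{-1/2}\,m\Big).$ -/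
open Real

/-- A function with `f' ≤ c - k f` up to a positive factor never exceeds
`f t0 + c / k`. -/
theorem le_add_div_of_hasDerivAt_le {f f' a : ℝ → ℝ} {t0 k c : ℝ} (hk : 0 < k) (hc : 0 ≤ c)
    (hf0 : 0 ≤ f t0) (ha : ∀ t ≥ t0, 0 < a t) (hf : ∀ t ≥ t0, HasDerivAt f (f' t) t)
    (hf' : ∀ t ≥ t0, f' t ≤ a t * (c - k * f t)) {t : ℝ} (ht : t0 ≤ t) :
    f t ≤ f t0 + c / k := by
  refine le_of_forall_pos_le_add fun ε hε => ?_
  have hck : 0 ≤ c / k := by positivity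
  refine image_le_of_deriv_right_lt_deriv_boundary (a := t0) (b := t)
    (B := fun _ => f t0 + c / k + ε) (B' := fun _ => 0)
    (fun s hs => (hf s hs.1).continuousAt.continuousWithinAt)
    (fun s hs => (hf s hs.1).hasDerivWithinAt) (by linarith)
    (fun s => hasDerivAt_const s _) (fun s hs hfs => ?_) ⟨ht, le_rfl⟩
  refine (hf' s hs.1).trans_lt (mul_neg_of_pos_of_neg (ha s hs.1) ?_)
  have hkc : k * (c / k) = c := by field_simp
  rw [hfs]
  nlinarith [mul_pos hk hε, mul_nonneg hk.le hf0]

/-- If `x' = -a x - w` with a positive gain satisfying `a' ≤ (σ / 2) a ^ 2` and `‖w‖ ≤ m`,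
then `a ‖x‖` exceeds its initial value by at most `m / √(1 - σ)`. -/
theorem norm_le_of_hasDerivAt_neg_smul_sub {E : Type*} [NormedAddCommGroup E]
    [InnerProductSpace ℝ E] {a a' : ℝ → ℝ} {x w : ℝ → E} {t0 σ m : ℝ} (hσ : σ < 1)
    (hm : 0 ≤ m) (ha : ∀ t ≥ t0, 0 < a t) (had : ∀ t ≥ t0, HasDerivAt a (a' t) t)
    (ha' : ∀ t ≥ t0, a' t ≤ σ / 2 * a t ^ 2) (hw : ∀ t ≥ t0, ‖w t‖ ≤ m)
    (hx : ∀ t ≥ t0, HasDerivAt x (-(a t) • x t - w t) t) {t : ℝ} (ht : t0 ≤ t) :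
    ‖x t‖ ≤ (a t)⁻¹ * (a t0 * ‖x t0‖ + (√(1 - σ))⁻¹ * m) := by
  have hk : 0 < 1 - σ := sub_pos.2 hσ
  have hsq := le_add_div_of_hasDerivAt_le (f := fun t => ‖a t • x t‖ ^ 2) (a := a) hk
    (sq_nonneg m) (by positivity) ha (fun s hs => ((had s hs).smul (hx s hs)).norm_sq)
    (fun s hs => ?_) ht
  · have hnorm : ∀ s ≥ t0, ‖a s • x s‖ = a s * ‖x s‖ := fun s hs => by
      rw [norm_smul, Real.norm_of_nonneg (ha s hs).le]
    simp only [hnorm t ht, hnorm t0 le_rfl] at hsq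
    have hat0 := ha t0 le_rfl
    rw [inv_mul_eq_div, le_div_iff₀' (ha t ht)]
    refine (abs_le_of_sq_le_sq' ?_ (by positivity)).2
    have hdiv : ((√(1 - σ))⁻¹ * m) ^ 2 = m ^ 2 / (1 - σ) := by
      rw [mul_pow, inv_pow, Real.sq_sqrt hk.le, inv_mul_eq_div]
    have hcross : 0 ≤ a t0 * ‖x t0‖ * ((√(1 - σ))⁻¹ * m) := by positivity
    nlinarith
  · have hpos := ha s hs
    have hinner : -(inner ℝ (x s) (w s)) ≤ ‖x s‖ * m :=
      (neg_le_abs _).trans ((abs_real_inner_le_norm _ _).trans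
        (mul_le_mul_of_nonneg_left (hw s hs) (norm_nonneg _)))
    simp only [Pi.smul_apply', norm_smul, Real.norm_of_nonneg hpos.le, inner_add_right, inner_sub_right,
      real_inner_smul_left, real_inner_smul_right, real_inner_self_eq_norm_sq]
    have hgain := mul_le_mul_of_nonneg_right (ha' s hs) (sq_nonneg ‖x s‖)
    have hdist := mul_le_mul_of_nonneg_left hinner hpos.le
    have hbound : 2 * (a' s * ‖x s‖ ^ 2 - a s ^ 2 * ‖x s‖ ^ 2 - a s * inner ℝ (x s) (w s)) ≤
        m ^ 2 - (1 - σ) * (a s * ‖x s‖) ^ 2 := by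
      nlinarith [sq_nonneg (a s * ‖x s‖ - m)]
    have := mul_le_mul_of_nonneg_left hbound hpos.le
    linarith

/-- Core convergence estimate (30) of Theorem 1 for the abstract error dynamics
`ẋ = -α(μ(t)) x - w`, with dynamic gain `μ` of class `𝒦_F` (positive, strictly
increasing, `μ̇ ≤ b̃ μ²`), feedback gain `α` (positive, strictly increasing,
`α'(s) ≤ (1/2) s⁻² b̃⁻¹ σ α(s)²`), disturbance-derivative bound `‖w(t)‖ ≤ m`,
and `σ̃ = 1 - σ`:
`‖x(t)‖ ≤ α(μ(t))⁻¹ (α(μ(t₀)) ‖x(t₀)‖ + σ̃^{-1/2} m)` for all `t ≥ t₀`. -/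
theorem stmt_13 (n : ℕ) (hn : 1 ≤ n) (t0 b σ m : ℝ)
    (hb : 0 < b) (hσ0 : 0 < σ) (hσ1 : σ < 1) (hm : 0 ≤ m)
    (σt : ℝ) (hσt : σt = 1 - σ)
    (μ μ' α α' : ℝ → ℝ)
    (hμpos : ∀ t ≥ t0, 0 < μ t)
    (hμdiff : ∀ t ≥ t0, HasDerivAt μ (μ' t) t)
    (hμmono : StrictMonoOn μ (Set.Ici t0))
    (hμ' : ∀ t ≥ t0, μ' t ≤ b * (μ t) ^ 2)
    (hαpos : ∀ s > (0 : ℝ), 0 < α s)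
    (hαdiff : ∀ s > (0 : ℝ), HasDerivAt α (α' s) s)
    (hαmono : StrictMonoOn α (Set.Ioi 0))
    (hα' : ∀ s > (0 : ℝ), α' s ≤ (1 / 2) * (s ^ 2)⁻¹ * b⁻¹ * σ * (α s) ^ 2)
    (x w : ℝ → EuclideanSpace ℝ (Fin n))
    (hw : ∀ t ≥ t0, ‖w t‖ ≤ m)
    (hx : ∀ t ≥ t0, HasDerivAt x (-(α (μ t)) • x t - w t) t) :
    ∀ t ≥ t0,
      ‖x t‖ ≤ (α (μ t))⁻¹ * (α (μ t0) * ‖x t0‖ + (Real.sqrt σt)⁻¹ * m) := by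
  subst hσt
  intro t ht
  refine norm_le_of_hasDerivAt_neg_smul_sub (a := fun t => α (μ t)) hσ1 hm
    (fun s hs => hαpos _ (hμpos s hs))
    (fun s hs => (hαdiff _ (hμpos s hs)).comp s (hμdiff s hs)) (fun s hs => ?_) hw hx ht
  have hμs := hμpos s hs
  have hα'nonneg : 0 ≤ α' (μ s) := by
    rw [← (hαdiff _ hμs).hasDerivWithinAt.derivWithin (isOpen_Ioi.uniqueDiffWithinAt hμs)]
    exact hαmono.monotoneOn.derivWithin_nonneg
  calc α' (μ s) * μ' s ≤ α' (μ s) * (b * μ s ^ 2) :=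
        mul_le_mul_of_nonneg_left (hμ' s hs) hα'nonneg
    _ ≤ ((1 / 2) * (μ s ^ 2)⁻¹ * b⁻¹ * σ * α (μ s) ^ 2) * (b * μ s ^ 2) :=
        mul_le_mul_of_nonneg_right (hα' _ hμs) (by positivity)
    _ = σ / 2 * α (μ s) ^ 2 := by field_simp
end

section
/- Let $n \geq 1$, $t_0 \in \mathbb{R}$, $\tilde{b} > 0$, $0 < \sigma < 1$, $m \geq 0$, and $0 < \underline{k} \leq \overline{k}$, and set $\tilde{\sigma} = 1 - \sigma$. Let $\mu : [t_0, \infty) \to (0, \infty)$ be differentiable, strictly increasing, with $\dot{\mu}(t) \leq \tilde{b}\,\mu(t)^2$; let $\alpha : (0,\infty) \to (0,\infty)$ be differentiable, strictly increasing, with $\frac{\mathrm{d}\alpha}{\mathrm{d}s}(s) \leq \frac{1}{2}s^{-2}\tilde{b}^{-1}\sigma\,\alpha(s)^2$ for all $s > 0$. Let $x, w : [t_0, \infty) \to \mathbb{R}^n$ with $x$ differentiable, $\|w(t)\| \leq m$, and $\dot{x}(t) = -\alpha(\mu(t))\,x(t) - w(t)$. For each $t \geq t_0$ let $M(t)$ be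 a real symmetric $n \times n$ matrix with $\underline{k}\,I_n \preceq M(t) \preceq \overline{k}\,I_n$, and define $\tilde{d}(t) = M(t)\,x(t)$. Then for all $t \geq t_0$: $\|\tilde{d}(t)\| \leq \big(\alpha(\mu(t))\big)^{-1}\Big(\overline{k}\,\underline{k}^{-1}\,\alpha(\mu(t_0))\,\|\tilde{d}(t_0)\| + \overline{k}\,\tilde{\sigma}^{-1/2}\,m\Big).$ -/
open Real
open scoped RealInnerProductSpace Matrix

/-- A symmetric operator whose quadratic form lies between `0` and `k ‖·‖²` has norm at most `k`. -/
theorem norm_apply_le_of_inner_le {E : Type*} [NormedAddCommGroup E] [InnerProductSpace ℝ E]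
    {T : E →L[ℝ] E} (hT : ∀ y z, ⟪T y, z⟫ = ⟪y, T z⟫) {k : ℝ} (hk : 0 < k)
    (hlb : ∀ y, 0 ≤ ⟪y, T y⟫) (hub : ∀ y, ⟪y, T y⟫ ≤ k * ‖y‖ ^ 2) (y : E) :
    ‖T y‖ ≤ k * ‖y‖ := by
  have h1 := hlb (k • y - T y)
  have h2 : ⟪k • y - T y, T (k • y - T y)⟫
      = k ^ 2 * ⟪y, T y⟫ - 2 * k * ‖T y‖ ^ 2 + ⟪T y, T (T y)⟫ := by
    simp only [map_sub, map_smul, inner_sub_left, inner_sub_right, real_inner_smul_left,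
      real_inner_smul_right, real_inner_self_eq_norm_sq, ← hT y (T y)]
    ring
  have h3 := mul_le_mul_of_nonneg_left (hub y) (sq_nonneg k)
  have h4 := hub (T y)
  refine abs_le_of_sq_le_sq' ?_ (by positivity) |>.2
  refine le_of_mul_le_mul_left ?_ hk
  nlinarith

/-- An operator with coercivity constant `k` expands norms by at least `k`. -/
theorem mul_norm_le_norm_apply_of_le_inner {E : Type*} [NormedAddCommGroup E]
    [InnerProductSpace ℝ E] {T : E →L[ℝ] E} {k : ℝ} (hlb : ∀ y, k * ‖y‖ ^ 2 ≤ ⟪y, T y⟫) (y : E) :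
    k * ‖y‖ ≤ ‖T y‖ := by
  rcases (norm_nonneg y).eq_or_lt with h | h
  · simp [← h]
  · have := (hlb y).trans (real_inner_le_norm y (T y))
    exact le_of_mul_le_mul_left (by linarith) h

/-- If `V' ≤ a (q - s V)` with `a, s > 0`, then `V` never exceeds a level `C ≥ q / s` it starts
below. -/
theorem le_of_hasDerivAt_le_mul_sub {V V' a : ℝ → ℝ} {t0 q s C : ℝ} (hs : 0 < s)
    (ha : ∀ t ≥ t0, 0 < a t) (hV : ∀ t ≥ t0, HasDerivAt V (V' t) t)
    (hV' : ∀ t ≥ t0, V' t ≤ a t * (q - s * V t)) (h0 : V t0 ≤ C) (hC : q ≤ s * C) :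
    ∀ t ≥ t0, V t ≤ C := by
  intro t ht
  refine le_of_forall_pos_le_add fun ε hε => ?_
  refine image_le_of_deriv_right_lt_deriv_boundary (f := V) (f' := V') (a := t0) (b := t)
    (B := fun _ => C + ε) (B' := fun _ => 0)
    (fun r hr => (hV r hr.1).continuousAt.continuousWithinAt)
    (fun r hr => (hV r hr.1).hasDerivWithinAt) (by linarith)
    (fun r => hasDerivAt_const r _) (fun r hr hVr => ?_) ⟨ht, le_rfl⟩
  refine (hV' r hr.1).trans_lt (mul_neg_of_pos_of_neg (ha r hr.1) ?_)
  rw [hVr]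
  nlinarith [mul_pos hs hε]

/-- Solutions of `ẋ = -a x - w` with `‖w‖ ≤ m` and a gain satisfying `ȧ ≤ (σ / 2) a²` have
`a ‖x‖` bounded by its initial value plus `m / √(1 - σ)`. -/
theorem gain_mul_norm_le {E : Type*} [NormedAddCommGroup E] [InnerProductSpace ℝ E]
    {a a' : ℝ → ℝ} {x w : ℝ → E} {t0 σ m : ℝ} (hσ : σ < 1) (hm : 0 ≤ m)
    (ha : ∀ t ≥ t0, 0 < a t) (hda : ∀ t ≥ t0, HasDerivAt a (a' t) t)
    (ha' : ∀ t ≥ t0, a' t ≤ σ / 2 * a t ^ 2) (hw : ∀ t ≥ t0, ‖w t‖ ≤ m)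
    (hx : ∀ t ≥ t0, HasDerivAt x (-(a t) • x t - w t) t) :
    ∀ t ≥ t0, a t * ‖x t‖ ≤ a t0 * ‖x t0‖ + (√(1 - σ))⁻¹ * m := by
  intro t ht
  have hs : 0 < 1 - σ := by linarith
  have key : a t ^ 2 * ‖x t‖ ^ 2 ≤ a t0 ^ 2 * ‖x t0‖ ^ 2 + m ^ 2 / (1 - σ) := by
    refine le_of_hasDerivAt_le_mul_sub (V := fun r => a r ^ 2 * ‖x r‖ ^ 2) (q := m ^ 2) hs ha
      (fun r hr => ((hda r hr).pow 2).mul (hx r hr).norm_sq) (fun r hr => ?_)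
      (le_add_of_nonneg_right (by positivity)) ?_ t ht
    · have har := ha r hr
      have hxw : -⟪x r, w r⟫ ≤ ‖x r‖ * m :=
        (neg_le_abs _).trans ((abs_real_inner_le_norm _ _).trans
          (mul_le_mul_of_nonneg_left (hw r hr) (norm_nonneg _)))
      have h1 := mul_le_mul_of_nonneg_left (ha' r hr)
        (show 0 ≤ 2 * a r * ‖x r‖ ^ 2 by positivity)
      have h2 := mul_le_mul_of_nonneg_left hxw (show 0 ≤ 2 * a r ^ 2 by positivity)
      have h3 := mul_nonneg har.le (sq_nonneg (a r * ‖x r‖ - m))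
      simp only [inner_sub_right, real_inner_smul_right, real_inner_self_eq_norm_sq, Pi.pow_apply]
      norm_num
      nlinarith
    · rw [mul_add, mul_div_cancel₀ _ hs.ne']
      exact le_add_of_nonneg_left (by positivity)
  have h0 : 0 ≤ a t0 * ‖x t0‖ := mul_nonneg (ha t0 le_rfl).le (norm_nonneg _)
  have h1 : 0 ≤ (√(1 - σ))⁻¹ * m := by positivity
  refine abs_le_of_sq_le_sq' ?_ (by positivity) |>.2
  have h2 : ((√(1 - σ))⁻¹ * m) ^ 2 = m ^ 2 / (1 - σ) := by
    rw [mul_pow, inv_pow, Real.sq_sqrt hs.le]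
    ring
  nlinarith [mul_nonneg h0 h1]

/-- Final estimate of Theorem 1 in abstract form: with the rescaled error dynamics
`ẋ = -α(μ(t)) x - w`, `‖w(t)‖ ≤ m`, dynamic gain `μ` of class `𝒦_F`
(`μ̇ ≤ b̃ μ²`), feedback gain `α` satisfying `α'(s) ≤ (1/2) s⁻² b̃⁻¹ σ α(s)²`,
symmetric matrices `k̲ I ≼ M(t) ≼ k̄ I`, `d̃(t) = M(t) x(t)`, and `σ̃ = 1 - σ`:
`‖d̃(t)‖ ≤ α(μ(t))⁻¹ (k̄ k̲⁻¹ α(μ(t₀)) ‖d̃(t₀)‖ + k̄ σ̃^{-1/2} m)` for all `t ≥ t₀`. -/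
theorem stmt_15 (n : ℕ) (hn : 1 ≤ n) (t0 b σ m kl ku : ℝ)
    (hb : 0 < b) (hσ0 : 0 < σ) (hσ1 : σ < 1) (hm : 0 ≤ m)
    (hkl : 0 < kl) (hklku : kl ≤ ku)
    (σt : ℝ) (hσt : σt = 1 - σ)
    (μ μ' α α' : ℝ → ℝ)
    (hμpos : ∀ t ≥ t0, 0 < μ t)
    (hμdiff : ∀ t ≥ t0, HasDerivAt μ (μ' t) t)
    (hμmono : StrictMonoOn μ (Set.Ici t0))
    (hμ' : ∀ t ≥ t0, μ' t ≤ b * (μ t) ^ 2)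
    (hαpos : ∀ s > (0 : ℝ), 0 < α s)
    (hαdiff : ∀ s > (0 : ℝ), HasDerivAt α (α' s) s)
    (hαmono : StrictMonoOn α (Set.Ioi 0))
    (hα' : ∀ s > (0 : ℝ), α' s ≤ (1 / 2) * (s ^ 2)⁻¹ * b⁻¹ * σ * (α s) ^ 2)
    (x w : ℝ → EuclideanSpace ℝ (Fin n))
    (hw : ∀ t ≥ t0, ‖w t‖ ≤ m)
    (hx : ∀ t ≥ t0, HasDerivAt x (-(α (μ t)) • x t - w t) t)
    (M : ℝ → Matrix (Fin n) (Fin n) ℝ)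
    (hMsym : ∀ t ≥ t0, (M t).IsSymm)
    (hMlb : ∀ t ≥ t0, ∀ y : EuclideanSpace ℝ (Fin n),
      kl * ‖y‖ ^ 2 ≤ ⟪y, (Matrix.toEuclideanCLM (𝕜 := ℝ) (M t)) y⟫)
    (hMub : ∀ t ≥ t0, ∀ y : EuclideanSpace ℝ (Fin n),
      ⟪y, (Matrix.toEuclideanCLM (𝕜 := ℝ) (M t)) y⟫ ≤ ku * ‖y‖ ^ 2)
    (dtil : ℝ → EuclideanSpace ℝ (Fin n))
    (hdtil : ∀ t ≥ t0, dtil t = (Matrix.toEuclideanCLM (𝕜 := ℝ) (M t)) (x t)) :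
    ∀ t ≥ t0,
      ‖dtil t‖ ≤ (α (μ t))⁻¹ *
        (ku * kl⁻¹ * α (μ t0) * ‖dtil t0‖ + ku * (Real.sqrt σt)⁻¹ * m) := by
  intro t ht
  subst hσt
  have hku : 0 < ku := hkl.trans_le hklku
  have hα'nonneg : ∀ s > (0 : ℝ), 0 ≤ α' s := fun s hs => by
    rw [← (hαdiff s hs).hasDerivWithinAt.derivWithin (isOpen_Ioi.uniqueDiffWithinAt hs)]
    exact hαmono.monotoneOn.derivWithin_nonneg
  have hgain : ∀ r ≥ t0, α' (μ r) * μ' r ≤ σ / 2 * α (μ r) ^ 2 := fun r hr => by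
    have hμr := hμpos r hr
    calc α' (μ r) * μ' r ≤ α' (μ r) * (b * μ r ^ 2) :=
          mul_le_mul_of_nonneg_left (hμ' r hr) (hα'nonneg _ hμr)
      _ ≤ (1 / 2) * (μ r ^ 2)⁻¹ * b⁻¹ * σ * α (μ r) ^ 2 * (b * μ r ^ 2) :=
          mul_le_mul_of_nonneg_right (hα' _ hμr) (by positivity)
      _ = σ / 2 * α (μ r) ^ 2 := by field_simp
  have hbound := gain_mul_norm_le (a := fun r => α (μ r)) hσ1 hm (fun r hr => hαpos _ (hμpos r hr))
    (fun r hr => (hαdiff _ (hμpos r hr)).comp r (hμdiff r hr)) hgain hw hx t ht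
  have hsymm : ∀ y z, ⟪Matrix.toEuclideanCLM (𝕜 := ℝ) (M t) y, z⟫
      = ⟪y, Matrix.toEuclideanCLM (𝕜 := ℝ) (M t) z⟫ := by
    have hH : (M t).IsHermitian := by
      rw [Matrix.IsHermitian, Matrix.conjTranspose_eq_transpose_of_trivial]
      exact hMsym t ht
    exact Matrix.isSymmetric_toEuclideanLin_iff.2 hH
  have hupper : ‖dtil t‖ ≤ ku * ‖x t‖ := by
    rw [hdtil t ht]
    exact norm_apply_le_of_inner_le hsymm hku
      (fun y => (by positivity : 0 ≤ kl * ‖y‖ ^ 2).trans (hMlb t ht y)) (hMub t ht) _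
  have hlower : ‖x t0‖ ≤ kl⁻¹ * ‖dtil t0‖ := by
    rw [hdtil t0 le_rfl, le_inv_mul_iff₀ hkl]
    exact mul_norm_le_norm_apply_of_le_inner (hMlb t0 le_rfl) _
  have hα0 := hαpos _ (hμpos t0 le_rfl)
  rw [le_inv_mul_iff₀ (hαpos _ (hμpos t ht))]
  calc α (μ t) * ‖dtil t‖ ≤ α (μ t) * (ku * ‖x t‖) :=
        mul_le_mul_of_nonneg_left hupper (hαpos _ (hμpos t ht)).le
    _ = ku * (α (μ t) * ‖x t‖) := by ring
    _ ≤ ku * (α (μ t0) * ‖x t0‖ + (√(1 - σ))⁻¹ * m) := mul_le_mul_of_nonneg_left hbound hku.le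
    _ ≤ ku * (α (μ t0) * (kl⁻¹ * ‖dtil t0‖) + (√(1 - σ))⁻¹ * m) := by gcongr
    _ = _ := by ring
end
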